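/- Let h_1,…,h_n ∈ H and let h = min_{i} h_i be their pointwise minimum. If h is concave, then for every constant random variable X = c (c ∈ ℝ): ⊟_{i=1}^n ρ_{h_i}(c) = ⊞_{i=1}^n ρ_{h_i}(c) = ρ_h(c) = □_{i=1}^n ρ_{h_i}(c) = c. -/

import Mathlib

open MeasureTheory ProbabilityTheory Set

noncomputable section

variable {Ω : Type*} [MeasurableSpace Ω]

/-- An atomless measure: every set of positive measure has a measurable subset of
strictly smaller positive measure. -/
def Atomless (P : Measure Ω) : Prop :=
  ∀ A : Set Ω, MeasurableSet A → 0 < P A →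
    ∃ B, B ⊆ A ∧ MeasurableSet B ∧ 0 < P B ∧ P B < P A

/-- Membership in the class `H` of distortion functions: increasing on `[0,1]`,
`h 0 = 0` and `h 1 = 1`. -/
def MemH (h : ℝ → ℝ) : Prop :=
  MonotoneOn h (Icc 0 1) ∧ h 0 = 0 ∧ h 1 = 1

/-- Two random variables are counter-monotonic. -/
def CounterMonotone (P : Measure Ω) (X Y : Ω → ℝ) : Prop :=
  ∀ᵐ p ∂(P.prod P), (X p.1 - X p.2) * (Y p.1 - Y p.2) ≤ 0

/-- Two random variables are comonotonic. -/
def Comonotone (P : Measure Ω) (X Y : Ω → ℝ) : Prop :=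
  ∀ᵐ p ∂(P.prod P), 0 ≤ (X p.1 - X p.2) * (Y p.1 - Y p.2)

/-- A random vector is pairwise counter-monotonic. -/
def PairwiseCtr (P : Measure Ω) {n : ℕ} (Xs : Fin n → Ω → ℝ) : Prop :=
  ∀ i j, i ≠ j → CounterMonotone P (Xs i) (Xs j)

/-- A random vector is (pairwise) comonotonic. -/
def PairwiseCom (P : Measure Ω) {n : ℕ} (Xs : Fin n → Ω → ℝ) : Prop :=
  ∀ i j, i ≠ j → Comonotone P (Xs i) (Xs j)

/-- The distortion risk measure `ρ_h(X) = ∫_0^∞ h(P(X ≥ x)) dx + ∫_{-∞}^0 (h(P(X ≥ x)) − 1) dx`. -/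
def distortion (P : Measure Ω) (h : ℝ → ℝ) (X : Ω → ℝ) : ℝ :=
  (∫ x in Ioi (0:ℝ), h ((P {ω | x ≤ X ω}).toReal)) +
    ∫ x in Iio (0:ℝ), (h ((P {ω | x ≤ X ω}).toReal) - 1)

/-- Bounded (essentially bounded, taking the everywhere-bounded representative)
measurable random variables. -/
def MemLinf (X : Ω → ℝ) : Prop :=
  Measurable X ∧ ∃ M : ℝ, ∀ ω, |X ω| ≤ M

/-- `Xs` is an allocation of `X` in `L^∞`. -/
def IsAlloc (P : Measure Ω) {n : ℕ} (X : Ω → ℝ) (Xs : Fin n → Ω → ℝ) : Prop :=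
  (∀ i, MemLinf (Xs i)) ∧ (∀ᵐ ω ∂P, ∑ i, Xs i ω = X ω)

/-- The (unconstrained) inf-convolution `□_{i=1}^n ρ_{h_i}(X)`, valued in `EReal`. -/
def infConv (P : Measure Ω) {n : ℕ} (h : Fin n → ℝ → ℝ) (X : Ω → ℝ) : EReal :=
  sInf {y : EReal | ∃ Xs : Fin n → Ω → ℝ, IsAlloc P X Xs ∧
    y = ((∑ i, distortion P (h i) (Xs i) : ℝ) : EReal)}

/-- The comonotonic inf-convolution `⊞_{i=1}^n ρ_{h_i}(X)`. -/
def comInfConv (P : Measure Ω) {n : ℕ} (h : Fin n → ℝ → ℝ) (X : Ω → ℝ) : EReal :=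
  sInf {y : EReal | ∃ Xs : Fin n → Ω → ℝ, IsAlloc P X Xs ∧ PairwiseCom P Xs ∧
    y = ((∑ i, distortion P (h i) (Xs i) : ℝ) : EReal)}

/-- The counter-monotonic inf-convolution `⊟_{i=1}^n ρ_{h_i}(X)`. -/
def ctrInfConv (P : Measure Ω) {n : ℕ} (h : Fin n → ℝ → ℝ) (X : Ω → ℝ) : EReal :=
  sInf {y : EReal | ∃ Xs : Fin n → Ω → ℝ, IsAlloc P X Xs ∧ PairwiseCtr P Xs ∧
    y = ((∑ i, distortion P (h i) (Xs i) : ℝ) : EReal)}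

/-- `h` is dually subadditive: `h` is subadditive and its dual `h̃(t) = 1 − h(1−t)`
is superadditive (on `[0,1]`). -/
def DuallySubadditive (h : ℝ → ℝ) : Prop :=
  (∀ x y : ℝ, 0 ≤ x → 0 ≤ y → x + y ≤ 1 → h (x + y) ≤ h x + h y) ∧
  (∀ x y : ℝ, 0 ≤ x → 0 ≤ y → x + y ≤ 1 →
    (1 - h (1 - x)) + (1 - h (1 - y)) ≤ 1 - h (1 - (x + y)))

lemma MemH.id : MemH (fun x => x) :=
  ⟨fun _ _ _ _ hxy => hxy, rfl, rfl⟩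

lemma MemLinf.integrable {P : Measure Ω} [IsProbabilityMeasure P] {X : Ω → ℝ} (hX : MemLinf X) :
    Integrable X P := by
  obtain ⟨hm, M, hM⟩ := hX
  exact Integrable.of_bound hm.aestronglyMeasurable M (.of_forall hM)

lemma MemH.antitone_survival {P : Measure Ω} [IsProbabilityMeasure P] {h : ℝ → ℝ} (hh : MemH h)
    (X : Ω → ℝ) : Antitone fun x => h ((P {ω | x ≤ X ω}).toReal) := by
  intro x y hxy
  refine hh.1 ⟨ENNReal.toReal_nonneg, measureReal_le_one⟩
    ⟨ENNReal.toReal_nonneg, measureReal_le_one⟩ ?_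
  exact measureReal_mono fun ω (hω : y ≤ X ω) => hxy.trans hω

lemma MemH.integrableOn_survival {P : Measure Ω} [IsProbabilityMeasure P] {h : ℝ → ℝ}
    (hh : MemH h) {X : Ω → ℝ} (hX : MemLinf X) :
    IntegrableOn (fun x => h ((P {ω | x ≤ X ω}).toReal)) (Ioi 0) := by
  obtain ⟨_, M, hM⟩ := hX
  have hIcc : IntegrableOn (fun x => h ((P {ω | x ≤ X ω}).toReal)) (Icc 0 M) :=
    ((hh.antitone_survival X).antitoneOn _).integrableOn_isCompact isCompact_Icc
  refine hIcc.of_forall_sdiff_eq_zero measurableSet_Ioi fun x hx => ?_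
  have hMx : M < x := by
    by_contra! hle
    exact hx.2 ⟨le_of_lt hx.1, hle⟩
  have hempty : {ω | x ≤ X ω} = ∅ := by
    ext ω
    simpa using ((abs_le.1 (hM ω)).2).trans_lt hMx
  simp [hempty, hh.2.1]

lemma MemH.integrableOn_survival_sub_one {P : Measure Ω} [IsProbabilityMeasure P] {h : ℝ → ℝ}
    (hh : MemH h) {X : Ω → ℝ} (hX : MemLinf X) :
    IntegrableOn (fun x => h ((P {ω | x ≤ X ω}).toReal) - 1) (Iio 0) := by
  obtain ⟨_, M, hM⟩ := hX
  have hIcc : IntegrableOn (fun x => h ((P {ω | x ≤ X ω}).toReal) - 1) (Icc (-M) 0) :=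
    (AntitoneOn.integrableOn_isCompact isCompact_Icc
      (fun x _ y _ hxy => sub_le_sub_right (hh.antitone_survival X hxy) 1))
  refine hIcc.of_forall_sdiff_eq_zero measurableSet_Iio fun x hx => ?_
  have hMx : x < -M := by
    by_contra! hle
    exact hx.2 ⟨hle, le_of_lt hx.1⟩
  have huniv : {ω | x ≤ X ω} = univ := by
    ext ω
    simpa using hMx.le.trans (abs_le.1 (hM ω)).1
  simp [huniv, hh.2.2]

lemma distortion_id {P : Measure Ω} [IsProbabilityMeasure P] {X : Ω → ℝ} (hX : MemLinf X) :
    distortion P (fun x => x) X = ∫ ω, X ω ∂P := by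
  have hint : Integrable X P := hX.integrable
  have hpos : ∫ x in Ioi (0:ℝ), (P {ω | x ≤ X ω}).toReal = ∫ ω, max (X ω) 0 ∂P := by
    rw [hint.pos_part.integral_eq_integral_meas_le (.of_forall fun ω => le_max_right _ _)]
    refine setIntegral_congr_fun measurableSet_Ioi fun x (hx : 0 < x) => ?_
    simp [Measure.real, hx.not_ge]
  have hneg : ∫ x in Iio (0:ℝ), ((P {ω | x ≤ X ω}).toReal - 1) = -∫ ω, max (-X ω) 0 ∂P := by
    rw [hint.neg_part.integral_eq_integral_meas_lt (.of_forall fun ω => le_max_right _ _),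
      ← integral_Iic_eq_integral_Iio, ← integral_neg, ← neg_zero, ← integral_comp_neg_Ioi, neg_zero]
    refine setIntegral_congr_fun measurableSet_Ioi fun x (hx : 0 < x) => ?_
    have hset : {ω | x < max (-X ω) 0} = {ω | -x ≤ X ω}ᶜ := by
      ext ω
      simp only [mem_ofPred_eq, mem_compl_iff, not_le, lt_max_iff, hx.not_gt, or_false]
      exact lt_neg
    have hcompl := probReal_compl_eq_one_sub (μ := P)
      (measurableSet_le (measurable_const (a := -x)) hX.1)
    simp only [Measure.real] at hcompl ⊢
    rw [hset, hcompl, neg_sub]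
  rw [distortion, hpos, hneg, ← sub_eq_add_neg, ← integral_sub hint.pos_part hint.neg_part]
  congr 1
  ext ω
  rcases le_total (X ω) 0 with hω | hω <;> simp [hω]

lemma MemH.integral_le_distortion {P : Measure Ω} [IsProbabilityMeasure P] {h : ℝ → ℝ}
    (hh : MemH h) (hle : ∀ x ∈ Icc (0:ℝ) 1, x ≤ h x) {X : Ω → ℝ} (hX : MemLinf X) :
    ∫ ω, X ω ∂P ≤ distortion P h X := by
  have hpt : ∀ x, (P {ω | x ≤ X ω}).toReal ≤ h ((P {ω | x ≤ X ω}).toReal) := fun x =>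
    hle _ ⟨ENNReal.toReal_nonneg, measureReal_le_one⟩
  rw [← distortion_id hX]
  exact add_le_add
    (setIntegral_mono (MemH.id.integrableOn_survival hX) (hh.integrableOn_survival hX) hpt)
    (setIntegral_mono (MemH.id.integrableOn_survival_sub_one hX)
      (hh.integrableOn_survival_sub_one hX) fun x => sub_le_sub_right (hpt x) 1)

lemma memLinf_const (c : ℝ) : MemLinf fun _ : Ω => c :=
  ⟨measurable_const, |c|, fun _ => le_rfl⟩

lemma distortion_const {P : Measure Ω} [IsProbabilityMeasure P] {h : ℝ → ℝ} (h0 : h 0 = 0)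
    (h1 : h 1 = 1) (c : ℝ) : distortion P h (fun _ => c) = c := by
  have hval : ∀ x : ℝ, h ((P {_ω | x ≤ c}).toReal) = (P {_ω | x ≤ c}).toReal := fun x => by
    by_cases hx : x ≤ c <;> simp [hx, h0, h1]
  have hid := distortion_id (P := P) (memLinf_const c)
  simp only [integral_const, probReal_univ, one_smul] at hid
  refine Eq.trans ?_ hid
  simp only [distortion, hval]

lemma ConcaveOn.self_le {h : ℝ → ℝ} (hconc : ConcaveOn ℝ (Icc 0 1) h) (h0 : h 0 = 0)
    (h1 : h 1 = 1) {x : ℝ} (hx : x ∈ Icc (0:ℝ) 1) : x ≤ h x := by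
  have := hconc.2 (left_mem_Icc.2 zero_le_one) (right_mem_Icc.2 zero_le_one)
    (sub_nonneg.2 hx.2) hx.1 (sub_add_cancel 1 x)
  simpa [h0, h1] using this

lemma IsAlloc.le_sum_distortion {P : Measure Ω} [IsProbabilityMeasure P] {n : ℕ}
    {h : Fin n → ℝ → ℝ} (hH : ∀ i, MemH (h i)) (hle : ∀ i, ∀ x ∈ Icc (0:ℝ) 1, x ≤ h i x)
    {X : Ω → ℝ} {Xs : Fin n → Ω → ℝ} (hXs : IsAlloc P X Xs) :
    ∫ ω, X ω ∂P ≤ ∑ i, distortion P (h i) (Xs i) := by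
  rw [← integral_congr_ae hXs.2, integral_finsetSum _ fun i _ => (hXs.1 i).integrable]
  exact Finset.sum_le_sum fun i _ => (hH i).integral_le_distortion (hle i) (hXs.1 i)

/-- sharing a constant payoff. If `h = min_i h_i` is concave, then for a
constant random variable `X = c` all three inf-convolutions and `ρ_h` equal `c`. -/
theorem constant_risk_sharing
    (P : Measure Ω) [IsProbabilityMeasure P] (hP : Atomless P)
    {n : ℕ} (hn : 0 < n)
    (h : Fin n → ℝ → ℝ) (hH : ∀ i, MemH (h i))
    (hmin : ℝ → ℝ) (hmin_def : ∀ x, hmin x = ⨅ i, h i x)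
    (hconc : ConcaveOn ℝ (Icc 0 1) hmin)
    (c : ℝ) :
    ctrInfConv P h (fun _ => c) = ((c : ℝ) : EReal) ∧
    comInfConv P h (fun _ => c) = ((c : ℝ) : EReal) ∧
    distortion P hmin (fun _ => c) = c ∧
    infConv P h (fun _ => c) = ((c : ℝ) : EReal) := by
  have : Nonempty (Fin n) := ⟨⟨0, hn⟩⟩
  have h0 : hmin 0 = 0 := by simp [hmin_def, (hH _).2.1]
  have h1 : hmin 1 = 1 := by simp [hmin_def, (hH _).2.2]
  have hle : ∀ i, ∀ x ∈ Icc (0:ℝ) 1, x ≤ h i x := fun i x hx =>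
    (hconc.self_le h0 h1 hx).trans <| (hmin_def x).trans_le <|
      ciInf_le (Set.finite_range _).bddBelow i
  have hlower : ∀ Xs : Fin n → Ω → ℝ, IsAlloc P (fun _ => c) Xs →
      (c : EReal) ≤ ((∑ i, distortion P (h i) (Xs i) : ℝ) : EReal) := fun Xs hXs => by
    have := hXs.le_sum_distortion hH hle
    simp only [integral_const, probReal_univ, one_smul] at this
    exact_mod_cast this
  let a : Fin n → ℝ := Pi.single ⟨0, hn⟩ c
  have hasum : ∑ i, a i = c := by simp [a]
  have halloc : IsAlloc P (fun _ => c) fun i _ => a i :=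
    ⟨fun i => memLinf_const _, .of_forall fun _ => hasum⟩
  have hcost : (c : EReal) =
      ((∑ i, distortion P (h i) (fun _ => a i) : ℝ) : EReal) := by
    simp only [distortion_const (hH _).2.1 (hH _).2.2, hasum]
  refine ⟨le_antisymm (sInf_le ⟨_, halloc, fun i j _ => .of_forall fun _ => by simp, hcost⟩)
      (le_sInf ?_),
    le_antisymm (sInf_le ⟨_, halloc, fun i j _ => .of_forall fun _ => by simp, hcost⟩)
      (le_sInf ?_),
    distortion_const h0 h1 c, le_antisymm (sInf_le ⟨_, halloc, hcost⟩) (le_sInf ?_)⟩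
  · rintro _ ⟨Xs, hXs, _, rfl⟩
    exact hlower Xs hXs
  · rintro _ ⟨Xs, hXs, _, rfl⟩
    exact hlower Xs hXs
  · rintro _ ⟨Xs, hXs, rfl⟩
    exact hlower Xs hXs
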